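/- arXiv:2011.10780 — 5 statements merged into one kernel-verified Lean document; each statement's English description precedes it below -/
import Mathlib

section
/- Let Ω₁ ∈ ℝ^{m×m} be symmetric, Ω₂ ∈ ℝ^{m×k}, and D ∈ ℝ^{k×k} be symmetric negative definite. Then there exists p > 0 such that the symmetric block matrix [[Ω₁, Ω₂],[Ω₂ᵀ, p·D]] is negative definite if and only if Ω₁ is negative definite. -/
noncomputable section

/-- A real matrix is negative definite iff its negation is positive definite. -/
def NegDef {n : Type*} [Fintype n] (M : Matrix n n ℝ) : Prop := (-M).PosDef

open scoped MatrixOrder in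
theorem Matrix.PosDef.exists_pos_algebraMap_le {n : Type*} [Fintype n] [DecidableEq n]
    {A : Matrix n n ℝ} (hA : A.PosDef) : ∃ r > 0, algebraMap ℝ (Matrix n n ℝ) r ≤ A := by
  cases isEmpty_or_nonempty n
  · exact ⟨1, one_pos, (Subsingleton.elim _ _).le⟩
  · exact (CFC.exists_pos_algebraMap_le_iff hA.isHermitian.isSelfAdjoint).2 fun x hx ↦
      (Matrix.isStrictlyPositive_iff_posDef.2 hA).spectrum_pos hx

open scoped MatrixOrder in
theorem Matrix.IsHermitian.exists_pos_le_algebraMap {n : Type*} [Fintype n] [DecidableEq n]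
    {S : Matrix n n ℝ} (hS : S.IsHermitian) : ∃ C > 0, S ≤ algebraMap ℝ (Matrix n n ℝ) C := by
  obtain ⟨C, hC⟩ := (Matrix.finite_real_spectrum (A := S)).bddAbove
  refine ⟨max C 1, by positivity, ?_⟩
  exact le_algebraMap_of_spectrum_le (fun x hx ↦ (hC hx).trans (le_max_left _ _)) hS.isSelfAdjoint

theorem Matrix.PosDef.exists_pos_sub_inv_smul {n : Type*} [Finite n] {A S : Matrix n n ℝ}
    (hA : A.PosDef) (hS : S.IsHermitian) : ∃ p : ℝ, 0 < p ∧ (A - p⁻¹ • S).PosDef := by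
  classical
  have := Fintype.ofFinite n
  obtain ⟨r, hr, hrA⟩ := hA.exists_pos_algebraMap_le
  obtain ⟨C, hC, hSC⟩ := hS.exists_pos_le_algebraMap
  refine ⟨2 * C / r, by positivity, ?_⟩
  have hε : 0 < (2 * C / r)⁻¹ := by positivity
  have key := (PosDef.one.smul (half_pos hr)).add_posSemidef
    ((Matrix.le_iff.1 hrA).add ((Matrix.le_iff.1 hSC).smul hε.le))
  have hcancel : (2 * C / r)⁻¹ * C = r / 2 := by field_simp
  have hsum : A - (2 * C / r)⁻¹ • S = (r / 2) • 1 + (A - algebraMap ℝ (Matrix n n ℝ) r +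
      (2 * C / r)⁻¹ • (algebraMap ℝ (Matrix n n ℝ) C - S)) := by
    simp only [Algebra.algebraMap_eq_smul_one, smul_sub, smul_smul, hcancel]
    module
  rw [hsum]
  exact key

/-- Schur complement criterion for positive definiteness. -/
theorem Matrix.PosDef.posDef_fromBlocks₂₂ {m n : Type*} [Finite m] [Fintype n] [DecidableEq n]
    {A : Matrix m m ℝ} {B : Matrix m n ℝ} {D : Matrix n n ℝ} (hD : D.PosDef)
    (h : (A - B * D⁻¹ * B.conjTranspose).PosDef) :
    (fromBlocks A B B.conjTranspose D).PosDef := by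
  classical
  have := Fintype.ofFinite m
  have := hD.isUnit.invertible
  rw [((hD.fromBlocks₂₂ A B).2 h.posSemidef).posDef_iff_isUnit,
    isUnit_fromBlocks_iff_of_invertible₂₂, invOf_eq_nonsing_inv]
  exact h.isUnit

/-- for symmetric `Ω₁`, arbitrary `Ω₂` and symmetric negative definite `D`,
there exists `p > 0` such that the block matrix `[[Ω₁, Ω₂],[Ω₂ᵀ, p·D]]` is negative
definite iff `Ω₁` is negative definite. -/
theorem block_negdef_iff (m k : ℕ)
    (Ω1 : Matrix (Fin m) (Fin m) ℝ) (Ω2 : Matrix (Fin m) (Fin k) ℝ)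
    (D : Matrix (Fin k) (Fin k) ℝ)
    (hΩ1 : Ω1.IsSymm) (hD : D.IsSymm) (hDneg : NegDef D) :
    (∃ p : ℝ, 0 < p ∧ NegDef (Matrix.fromBlocks Ω1 Ω2 Ω2.transpose (p • D)))
      ↔ NegDef Ω1 := by
  refine ⟨fun ⟨p, _, h⟩ ↦ h.submatrix Sum.inl_injective, fun h ↦ ?_⟩
  have hS : ((-Ω2) * (-D)⁻¹ * (-Ω2).conjTranspose).IsHermitian :=
    Matrix.isHermitian_mul_mul_conjTranspose _ hDneg.inv.isHermitian
  obtain ⟨p, hp, hpS⟩ := Matrix.PosDef.exists_pos_sub_inv_smul h hS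
  refine ⟨p, hp, ?_⟩
  have hpD : (p • -D).PosDef := Matrix.PosDef.smul hDneg hp
  have hinv : (p • -D)⁻¹ = p⁻¹ • (-D)⁻¹ := by
    have := invertibleOfNonzero hp.ne'
    rw [Matrix.inv_smul _ _ ((Matrix.isUnit_iff_isUnit_det _).1 hDneg.isUnit), invOf_eq_inv]
  have key := hpD.posDef_fromBlocks₂₂ (A := -Ω1) (B := -Ω2) (by
    rwa [hinv, Matrix.mul_smul, Matrix.smul_mul])
  rw [NegDef, Matrix.fromBlocks_neg]
  simpa [Matrix.conjTranspose_eq_transpose_of_trivial] using key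
end
end

section
/- Let m ≥ 1, let F₀ ∈ ℝ^{m×m}, 𝓚₀ ∈ ℝ^{1×m}, 𝓛₀ ∈ ℝ^{m×1}, let P₀ ∈ ℝ^{m×m} be symmetric positive definite, let q, δ ∈ ℝ, and let (s_N)_{N≥1} be a nonincreasing sequence of nonnegative reals. For an integer N ≥ 1 with λ_{N+1} − 2q − 2δ > 0, where λ_n = n²π², define M(N) := P₀F₀ + F₀ᵀP₀ + 2δP₀ + (2/(π²N))·𝓚₀ᵀ𝓚₀ + (s_N/(λ_{N+1} − 2q − 2δ))·P₀𝓛₀𝓛₀ᵀP₀. If M(N) is negative definite, then M(N+1) is negative definite (note λ_{N+2} > λ_{N+1}, so λ_{N+2} − 2q − 2δ > 0). -/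
noncomputable section

/-- Eigenvalues of the Neumann Sturm–Liouville problem: `λ_n = n²π²`. -/
def lam (n : ℕ) : ℝ := (n : ℝ) ^ 2 * Real.pi ^ 2

open Matrix in
/-- Negative definiteness is inherited downwards in the Loewner order. -/
theorem NegDef.of_posSemidef_sub {n : Type*} [Fintype n] {A B : Matrix n n ℝ}
    (hA : NegDef A) (hAB : (A - B).PosSemidef) : NegDef B := by
  have h : -B = -A + (A - B) := by abel
  rw [NegDef, h]
  exact PosDef.add_posSemidef hA hAB

theorem lam_strictMono : StrictMono lam := fun a b hab => by
  have : (a : ℝ) < b := by exact_mod_cast hab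
  unfold lam
  gcongr

/-- monotonicity of the reduced-order LMI in the observer dimension `N`:
if `M(N) < 0` then `M(N+1) < 0`, where
`M(N) = P₀F₀ + F₀ᵀP₀ + 2δP₀ + (2/(π²N))·𝓚₀ᵀ𝓚₀ + (s_N/(λ_{N+1} − 2q − 2δ))·P₀𝓛₀𝓛₀ᵀP₀`. -/
theorem reduced_LMI_monotone (m : ℕ) (hm : 1 ≤ m)
    (F0 : Matrix (Fin m) (Fin m) ℝ)
    (K0 : Matrix (Fin 1) (Fin m) ℝ) (L0 : Matrix (Fin m) (Fin 1) ℝ)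
    (P0 : Matrix (Fin m) (Fin m) ℝ) (hP0 : P0.PosDef)
    (q δ : ℝ) (s : ℕ → ℝ) (hs_anti : Antitone s) (hs_nonneg : ∀ n, 0 ≤ s n)
    (N : ℕ) (hN : 1 ≤ N) (hlam : 0 < lam (N + 1) - 2 * q - 2 * δ)
    (hMN : NegDef (P0 * F0 + F0.transpose * P0 + (2 * δ) • P0
      + (2 / (Real.pi ^ 2 * (N : ℝ))) • (K0.transpose * K0)
      + (s N / (lam (N + 1) - 2 * q - 2 * δ)) • (P0 * L0 * L0.transpose * P0))) :
    0 < lam (N + 2) - 2 * q - 2 * δ ∧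
    NegDef (P0 * F0 + F0.transpose * P0 + (2 * δ) • P0
      + (2 / (Real.pi ^ 2 * ((N : ℝ) + 1))) • (K0.transpose * K0)
      + (s (N + 1) / (lam (N + 2) - 2 * q - 2 * δ)) • (P0 * L0 * L0.transpose * P0)) := by
  have hmono : lam (N + 1) < lam (N + 2) := lam_strictMono (by omega)
  refine ⟨by linarith, hMN.of_posSemidef_sub ?_⟩
  have hN0 : (0 : ℝ) < N := by exact_mod_cast hN
  have hK : 2 / (Real.pi ^ 2 * ((N : ℝ) + 1)) ≤ 2 / (Real.pi ^ 2 * (N : ℝ)) := by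
    gcongr
    linarith
  have hL : s (N + 1) / (lam (N + 2) - 2 * q - 2 * δ)
      ≤ s N / (lam (N + 1) - 2 * q - 2 * δ) :=
    div_le_div₀ (hs_nonneg N) (hs_anti N.le_succ) hlam (by linarith)
  have hKK : (K0.transpose * K0).PosSemidef := by
    simpa using Matrix.posSemidef_conjTranspose_mul_self K0
  have hPT : P0.transpose = P0 := by simpa using hP0.isHermitian.eq
  have hLL : (P0 * L0 * L0.transpose * P0).PosSemidef := by
    simpa [Matrix.transpose_mul, hPT, Matrix.mul_assoc] using
      Matrix.posSemidef_self_mul_conjTranspose (P0 * L0)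
  convert (hKK.smul (sub_nonneg.2 hK)).add (hLL.smul (sub_nonneg.2 hL)) using 1
  simp only [sub_smul]
  abel
end
end

section
/- Let m ≥ 1, let F₀ ∈ ℝ^{m×m}, 𝓚₀ ∈ ℝ^{1×m}, 𝓛₀ ∈ ℝ^{m×1}, let q, δ ∈ ℝ, and suppose there exists a symmetric positive definite P₀ ∈ ℝ^{m×m} such that P₀F₀ + F₀ᵀP₀ + 2δP₀ is negative definite. Let (s_N)_{N≥1} be a sequence of nonnegative reals with s_N → 0 as N → ∞, and λ_n = n²π². Then there exists N₁ ≥ 1 such that for every N ≥ N₁ one has λ_{N+1} − 2q − 2δ > 0 and P₀F₀ + F₀ᵀP₀ + 2δP₀ + (2/(π²N))·𝓚₀ᵀ𝓚₀ + (s_N/(λ_{N+1} − 2q − 2δ))·P₀𝓛₀𝓛₀ᵀP₀ is negative definite. -/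
noncomputable section

open Filter Topology in
/-- Positive definiteness is an open condition among Hermitian real matrices. -/
theorem Matrix.PosDef.eventually_posDef {n : Type*} [Fintype n] {A : Matrix n n ℝ}
    (hA : A.PosDef) : ∀ᶠ B in 𝓝 A, B.IsHermitian → B.PosDef := by
  have hopen : ∀ᶠ B in 𝓝 A, ∀ x ∈ Metric.sphere (0 : n → ℝ) 1, 0 < x ⬝ᵥ B.mulVec x := by
    refine (isCompact_sphere (0 : n → ℝ) 1).eventually_forall_of_forall_eventually ?_
    intro x hx
    have hcont : Continuous fun z : Matrix n n ℝ × (n → ℝ) => z.2 ⬝ᵥ z.1.mulVec z.2 := by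
      fun_prop
    refine hcont.continuousAt.eventually (lt_mem_nhds ?_)
    simpa using hA.dotProduct_mulVec_pos (ne_zero_of_mem_unit_sphere ⟨x, hx⟩)
  filter_upwards [hopen] with B hB hherm
  refine Matrix.PosDef.of_dotProduct_mulVec_pos hherm fun x hx => ?_
  have hnorm : 0 < ‖x‖ := norm_pos_iff.mpr hx
  have hpos := hB (‖x‖⁻¹ • x) (by simp [norm_smul, hnorm.ne'])
  rw [Matrix.mulVec_smul, smul_dotProduct, dotProduct_smul, smul_smul, smul_eq_mul] at hpos
  simpa using pos_of_mul_pos_right hpos (by positivity)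

theorem tendsto_lam_atTop : Filter.Tendsto lam Filter.atTop Filter.atTop :=
  ((Filter.tendsto_pow_atTop two_ne_zero).comp tendsto_natCast_atTop_atTop).atTop_mul_const
    (by positivity)

/-- feasibility of the reduced-order LMI for all large enough `N`:
if `P₀F₀ + F₀ᵀP₀ + 2δP₀ < 0` and `s_N → 0`, then there is `N₁ ≥ 1` such that for all
`N ≥ N₁`, `λ_{N+1} − 2q − 2δ > 0` and
`P₀F₀ + F₀ᵀP₀ + 2δP₀ + (2/(π²N))·𝓚₀ᵀ𝓚₀ + (s_N/(λ_{N+1} − 2q − 2δ))·P₀𝓛₀𝓛₀ᵀP₀ < 0`. -/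
theorem reduced_LMI_feasible_for_large_N (m : ℕ) (hm : 1 ≤ m)
    (F0 : Matrix (Fin m) (Fin m) ℝ)
    (K0 : Matrix (Fin 1) (Fin m) ℝ) (L0 : Matrix (Fin m) (Fin 1) ℝ)
    (q δ : ℝ)
    (P0 : Matrix (Fin m) (Fin m) ℝ) (hP0 : P0.PosDef)
    (hLyap : NegDef (P0 * F0 + F0.transpose * P0 + (2 * δ) • P0))
    (s : ℕ → ℝ) (hs_nonneg : ∀ n, 0 ≤ s n)
    (hs0 : Filter.Tendsto s Filter.atTop (nhds 0)) :
    ∃ N1 : ℕ, 1 ≤ N1 ∧ ∀ N, N1 ≤ N →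
      0 < lam (N + 1) - 2 * q - 2 * δ ∧
      NegDef (P0 * F0 + F0.transpose * P0 + (2 * δ) • P0
        + (2 / (Real.pi ^ 2 * (N : ℝ))) • (K0.transpose * K0)
        + (s N / (lam (N + 1) - 2 * q - 2 * δ)) • (P0 * L0 * L0.transpose * P0)) := by
  have hgap : Filter.Tendsto (fun N => lam (N + 1) - 2 * q - 2 * δ) Filter.atTop Filter.atTop :=
    Filter.tendsto_atTop_add_const_right _ _ (Filter.tendsto_atTop_add_const_right _ _
      (tendsto_lam_atTop.comp (Filter.tendsto_add_atTop_nat 1)))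
  have hK : Filter.Tendsto (fun N : ℕ => 2 / (Real.pi ^ 2 * (N : ℝ))) Filter.atTop (nhds 0) :=
    Filter.Tendsto.const_div_atTop
      (tendsto_natCast_atTop_atTop.const_mul_atTop (by positivity)) 2
  have hL := hs0.div_atTop hgap
  have hlim := (((tendsto_const_nhds (x := P0 * F0 + F0.transpose * P0 + (2 * δ) • P0)).add
    (hK.smul_const (K0.transpose * K0))).add
    (hL.smul_const (P0 * L0 * L0.transpose * P0))).neg
  simp only [zero_smul, add_zero] at hlim
  obtain ⟨N1, hN1⟩ := Filter.eventually_atTop.mp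
    ((hgap.eventually_gt_atTop 0).and (hlim.eventually hLyap.eventually_posDef))
  refine ⟨max N1 1, le_max_right _ _, fun N hN => ?_⟩
  obtain ⟨hpos, hdef⟩ := hN1 N ((le_max_left _ _).trans hN)
  refine ⟨hpos, hdef (Matrix.IsHermitian.neg (.add (.add ?_ ?_) ?_))⟩
  · simpa using hLyap.isHermitian.neg
  · simp [Matrix.IsHermitian, Matrix.conjTranspose_eq_transpose_of_trivial]
  · have hP : P0.transpose = P0 := hP0.isHermitian
    simp [Matrix.IsHermitian, Matrix.conjTranspose_eq_transpose_of_trivial, hP,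
      Matrix.mul_assoc]
end
end

section
/- Let M₁ ∈ ℝ^{m×m}, M₂ ∈ ℝ^{k×k}, G ∈ ℝ^{m×k} and δ > 0. Suppose there exist symmetric positive definite matrices P_c ∈ ℝ^{m×m} and P_o ∈ ℝ^{k×k} such that P_cM₁ + M₁ᵀP_c + 2δP_c < 0 and P_oM₂ + M₂ᵀP_o + 2δP_o < 0. Then for the block upper-triangular matrix F = [[M₁, G],[0, M₂]] there exists ρ > 0 such that P := diag(P_c, ρP_o) is symmetric positive definite and satisfies PF + FᵀP + 2δP < 0. -/
noncomputable section

namespace Matrix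

/-- A block matrix is positive definite if its upper left block and the corresponding Schur
complement are. -/
theorem PosDef.fromBlocks_of_schurComplement {m n : Type*} [Fintype m] [DecidableEq m] [Fintype n]
    {A : Matrix m m ℝ} (B : Matrix m n ℝ) (D : Matrix n n ℝ) (hA : A.PosDef)
    (hS : (D - Bᴴ * A⁻¹ * B).PosDef) : (fromBlocks A B Bᴴ D).PosDef := by
  have : Invertible A := hA.isUnit.invertible
  refine .of_dotProduct_mulVec_pos ((IsHermitian.fromBlocks₁₁ B D hA.1).2 hS.1) fun x hx => ?_
  rw [dotProduct_mulVec, ← Sum.elim_comp_inl_inr x, schur_complement_eq₁₁ B D _ _ hA.1,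
    ← dotProduct_mulVec, ← dotProduct_mulVec (star (x ∘ Sum.inr))]
  by_cases hy : x ∘ Sum.inr = 0
  · have hx' : x ∘ Sum.inl ≠ 0 := fun h => hx <| by
      rw [← Sum.elim_comp_inl_inr x, h, hy]
      exact Sum.elim_zero_zero
    simpa [hy] using hA.dotProduct_mulVec_pos hx'
  · exact add_pos_of_nonneg_of_pos (hA.posSemidef.dotProduct_mulVec_nonneg _)
      (hS.dotProduct_mulVec_pos hy)

/-- A block diagonal matrix with positive definite blocks is positive definite. -/
theorem PosDef.fromBlocks_zero {m n : Type*} [Fintype m] [Fintype n]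
    {A : Matrix m m ℝ} {D : Matrix n n ℝ} (hA : A.PosDef) (hD : D.PosDef) :
    (fromBlocks A 0 0 D).PosDef := by
  classical
  simpa using PosDef.fromBlocks_of_schurComplement (0 : Matrix m n ℝ) D hA (by simpa using hD)

/-- A sufficiently large multiple of a positive definite matrix dominates a given symmetric
matrix. -/
theorem PosDef.exists_pos_smul_sub {n : Type*} [Fintype n] {D S : Matrix n n ℝ}
    (hD : D.PosDef) (hS : S.IsHermitian) : ∃ ρ : ℝ, 0 < ρ ∧ (ρ • D - S).PosDef := by
  have hcont (M : Matrix n n ℝ) : Continuous fun x : n → ℝ => x ⬝ᵥ (M *ᵥ x) := by fun_prop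
  have hpos {x : n → ℝ} (hx : x ≠ 0) : 0 < x ⬝ᵥ (D *ᵥ x) := by
    simpa using hD.dotProduct_mulVec_pos hx
  obtain ⟨c, hc⟩ := (isCompact_sphere (0 : n → ℝ) 1).bddAbove_image
    (f := fun x => x ⬝ᵥ (S *ᵥ x) / x ⬝ᵥ (D *ᵥ x))
    ((hcont S).continuousOn.div (hcont D).continuousOn fun x hx =>
      (hpos (ne_zero_of_mem_unit_sphere ⟨x, hx⟩)).ne')
  refine ⟨max c 0 + 1, by positivity, .of_dotProduct_mulVec_pos
    ((hD.1.smul (IsSelfAdjoint.all _)).sub hS) fun x hx => ?_⟩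
  have hmem : ‖x‖⁻¹ • x ∈ Metric.sphere (0 : n → ℝ) 1 := by
    simp [norm_smul, hx]
  have hle := hc ⟨_, hmem, rfl⟩
  have hnorm : ‖x‖ ≠ 0 := norm_ne_zero_iff.2 hx
  simp only [mulVec_smul, smul_dotProduct, dotProduct_smul, smul_eq_mul] at hle
  rw [mul_div_mul_left _ _ (inv_ne_zero hnorm), mul_div_mul_left _ _ (inv_ne_zero hnorm),
    div_le_iff₀ (hpos hx)] at hle
  simp only [star_trivial, sub_mulVec, smul_mulVec, dotProduct_sub, dotProduct_smul, smul_eq_mul]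
  nlinarith [hpos hx, le_max_left c 0]

end Matrix

/-- combining a controller Lyapunov inequality for `M₁` and an observer
Lyapunov inequality for `M₂` into a single Lyapunov inequality for the block
upper-triangular matrix `F = [[M₁, G],[0, M₂]]` with `P = diag(P_c, ρP_o)`. -/
theorem block_triangular_lyapunov (m k : ℕ)
    (M1 : Matrix (Fin m) (Fin m) ℝ) (M2 : Matrix (Fin k) (Fin k) ℝ)
    (G : Matrix (Fin m) (Fin k) ℝ) (δ : ℝ) (hδ : 0 < δ)
    (Pc : Matrix (Fin m) (Fin m) ℝ) (Po : Matrix (Fin k) (Fin k) ℝ)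
    (hPc : Pc.PosDef) (hPo : Po.PosDef)
    (h1 : NegDef (Pc * M1 + M1.transpose * Pc + (2 * δ) • Pc))
    (h2 : NegDef (Po * M2 + M2.transpose * Po + (2 * δ) • Po)) :
    ∃ ρ : ℝ, 0 < ρ ∧
      (Matrix.fromBlocks Pc 0 0 (ρ • Po)).PosDef ∧
      NegDef ((Matrix.fromBlocks Pc 0 0 (ρ • Po)) * (Matrix.fromBlocks M1 G 0 M2)
        + (Matrix.fromBlocks M1 G 0 M2).transpose * (Matrix.fromBlocks Pc 0 0 (ρ • Po))
        + (2 * δ) • (Matrix.fromBlocks Pc 0 0 (ρ • Po))) := by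
  have hBH : ((-(Pc * G)).conjTranspose : Matrix _ _ ℝ) = -(G.transpose * Pc) := by
    rw [Matrix.conjTranspose_neg, Matrix.conjTranspose_mul, hPc.1.eq,
      Matrix.conjTranspose_eq_transpose_of_trivial]
  obtain ⟨ρ, hρ, hS⟩ := h2.exists_pos_smul_sub
    (Matrix.isHermitian_conjTranspose_mul_mul (-(Pc * G)) h1.1.inv)
  refine ⟨ρ, hρ, hPc.fromBlocks_zero (hPo.smul hρ), ?_⟩
  have hblock := Matrix.PosDef.fromBlocks_of_schurComplement (-(Pc * G)) _ h1 hS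
  rw [hBH] at hblock
  unfold NegDef
  convert hblock using 1
  simp [Matrix.fromBlocks_transpose, Matrix.fromBlocks_multiply, Matrix.fromBlocks_add,
    Matrix.fromBlocks_smul, Matrix.fromBlocks_neg, smul_comm ρ]
end
end

section
/- (Halanay's inequality) Let 0 < δ₁ < δ₀, τ_M > 0 and t₀ ∈ ℝ. Let W: [t₀ − τ_M, ∞) → [0, ∞) be continuous, locally absolutely continuous on [t₀, ∞), and satisfy for almost every t ≥ t₀: W'(t) + 2δ₀·W(t) − 2δ₁·sup_{−τ_M ≤ θ ≤ 0} W(t+θ) ≤ 0. Then for all t ≥ t₀, W(t) ≤ exp(−2δ_{τ_M}(t − t₀))·sup_{−τ_M ≤ θ ≤ 0} W(t₀ + θ), where δ_{τ_M} > 0 is the unique positive solution of δ_{τ_M} = δ₀ − δ₁·exp(2δ_{τ_M}τ_M). -/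
noncomputable section

open MeasureTheory intervalIntegral

/-- A strict exponential upper bound on the initial window propagates to all later times. -/
theorem lt_exp_of_delay_inequality {δ0 δ1 τM t0 : ℝ}
    (h1 : 0 < δ1) (h12 : δ1 < δ0) (hτ : 0 < τM) {W W' : ℝ → ℝ}
    (hW_cont : ContinuousOn W (Set.Ici (t0 - τM)))
    (hW'_int : ∀ a b : ℝ, t0 ≤ a → IntervalIntegrable W' volume a b)
    (hW_ftc : ∀ t, t0 ≤ t → W t = W t0 + ∫ s in t0..t, W' s)
    (hineq : ∀ᵐ t ∂volume, t0 ≤ t →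
      W' t + 2 * δ0 * W t - 2 * δ1 * sSup (W '' Set.Icc (t - τM) t) ≤ 0)
    {δτ : ℝ} (hδτ_pos : 0 < δτ)
    (hδτ_eq : δτ = δ0 - δ1 * Real.exp (2 * δτ * τM))
    {K : ℝ} (hK : 0 < K) (hinit : ∀ t ∈ Set.Icc (t0 - τM) t0, W t < K)
    {t : ℝ} (ht : t0 ≤ t) : W t < K * Real.exp (-2 * δτ * (t - t0)) := by
  set y : ℝ → ℝ := fun s => K * Real.exp (-2 * δτ * (s - t0)) with hy
  have hy_cont : Continuous y := by fun_prop
  have hy_anti : ∀ r s, r ≤ s → y s ≤ y r := fun r s hrs => by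
    refine mul_le_mul_of_nonneg_left (Real.exp_le_exp.2 ?_) hK.le
    nlinarith
  have hy_init : ∀ s ∈ Set.Icc (t0 - τM) t0, W s < y s := fun s hs => by
    have := hy_anti s t0 hs.2
    have h0 : y t0 = K := by simp [hy]
    linarith [hinit s hs]
  have hy_delay : ∀ s, y (s - τM) = Real.exp (2 * δτ * τM) * y s := fun s => by
    simp only [hy]
    rw [mul_left_comm, ← Real.exp_add]
    ring_nf
  have hy_deriv : ∀ s, HasDerivAt y (-2 * δτ * y s) s := fun s => by
    have := ((((hasDerivAt_id s).sub_const t0).const_mul (-2 * δτ)).exp).const_mul K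
    refine this.congr_deriv ?_
    simp only [hy, id]
    ring
  by_contra! hcon
  have hv_cont : ContinuousOn (fun s => y s - W s) (Set.Ici (t0 - τM)) :=
    hy_cont.continuousOn.sub hW_cont
  obtain ⟨T, ⟨⟨hT0, -⟩, hTv⟩, hTmin⟩ :
      ∃ T, IsLeast (Set.Icc t0 t ∩ (fun s => y s - W s) ⁻¹' Set.Iic 0) T := by
    refine IsCompact.exists_isLeast ?_ ⟨t, ⟨ht, le_rfl⟩, sub_nonpos.2 hcon⟩
    refine isCompact_Icc.of_isClosed_subset ?_ Set.inter_subset_left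
    exact (hv_cont.mono fun s hs => by
      simp only [Set.mem_Icc, Set.mem_Ici] at *; linarith).preimage_isClosed_of_isClosed
        isClosed_Icc isClosed_Iic
  simp only [Set.mem_preimage, Set.mem_Iic] at hTv
  have hbefore : ∀ s, t0 - τM ≤ s → s < T → W s < y s := fun s hs hsT => by
    rcases le_total s t0 with h | h
    · exact hy_init s ⟨hs, h⟩
    · by_contra! hle
      have hTt : T ≤ t := by
        by_contra! htT
        exact absurd (hTmin ⟨⟨ht, le_rfl⟩, sub_nonpos.2 hcon⟩) (not_le.2 htT)
      exact absurd (hTmin ⟨⟨h, hsT.le.trans hTt⟩, sub_nonpos.2 hle⟩) (not_le.2 hsT)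
  have htT : t0 < T := by
    refine lt_of_le_of_ne hT0 fun h => ?_
    have := hy_init t0 ⟨by linarith, le_rfl⟩
    rw [← h] at hTv
    linarith
  have hδ0 : 0 < δ0 := h1.trans h12
  set a := max t0 (T - 1 / (4 * δ0)) with ha
  have hat0 : t0 ≤ a := le_max_left _ _
  have haT : a < T := max_lt htT (by have : 0 < 1 / (4 * δ0) := by positivity
                                     linarith)
  have hTa : 2 * δ0 * (T - a) ≤ 1 / 2 := by
    have h := le_max_right t0 (T - 1 / (4 * δ0))
    have h' : 2 * δ0 * (1 / (4 * δ0)) = 1 / 2 := by field_simp; norm_num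
    nlinarith
  obtain ⟨m, ⟨ham, hmT⟩, hmax⟩ := isCompact_Icc.exists_isMaxOn (Set.nonempty_Icc.2 haT.le)
    (hv_cont.mono fun s (hs : s ∈ Set.Icc a T) => by
      simp only [Set.mem_Icc, Set.mem_Ici] at *; linarith)
  set V := y m - W m with hV
  have hVpos : 0 < V := by
    have h := hmax (show a ∈ Set.Icc a T from ⟨le_rfl, haT.le⟩)
    have h' := hbefore a (by linarith) haT
    simp only [Set.mem_ofPred_eq] at h
    linarith
  have hy_int : IntervalIntegrable (fun s => -2 * δτ * y s) volume m T :=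
    (hy_cont.const_mul _).intervalIntegrable _ _
  have hmono : ∫ s in m..T, (W' s - -2 * δτ * y s) ≤ ∫ _ in m..T, 2 * δ0 * V := by
    refine intervalIntegral.integral_mono_ae_restrict hmT
      ((hW'_int m T (by linarith)).sub hy_int) intervalIntegrable_const ?_
    refine (ae_restrict_iff' measurableSet_Icc).2 ?_
    filter_upwards [hineq, Measure.ae_ne volume T] with s hs hsT hsmem
    have hsT : s < T := lt_of_le_of_ne hsmem.2 hsT
    have hst0 : t0 ≤ s := by linarith [hsmem.1]
    have hsup : sSup (W '' Set.Icc (s - τM) s) ≤ Real.exp (2 * δτ * τM) * y s := by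
      refine csSup_le ((Set.nonempty_Icc.2 (by linarith)).image W) ?_
      rintro _ ⟨r, ⟨hr1, hr2⟩, rfl⟩
      rw [← hy_delay]
      exact (hbefore r (by linarith) (by linarith)).le.trans (hy_anti _ _ hr1)
    have hsV := hmax (show s ∈ Set.Icc a T from ⟨ham.trans hsmem.1, hsT.le⟩)
    simp only [Set.mem_ofPred_eq] at hsV
    have e1 := hs hst0
    have e2 := mul_le_mul_of_nonneg_left hsup h1.le
    have e3 : δτ * y s = δ0 * y s - δ1 * (Real.exp (2 * δτ * τM) * y s) := by
      linear_combination y s * hδτ_eq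
    have e4 := mul_le_mul_of_nonneg_left hsV hδ0.le
    linarith
  rw [intervalIntegral.integral_sub (hW'_int m T (by linarith)) hy_int,
    integral_eq_sub_of_hasDerivAt (fun s _ => hy_deriv s) hy_int,
    intervalIntegral.integral_const, smul_eq_mul] at hmono
  have hadd := integral_add_adjacent_intervals (hW'_int t0 m le_rfl)
    (hW'_int m T (by linarith))
  have hWm := hW_ftc m (by linarith)
  have hWT := hW_ftc T hT0
  have hprod := mul_le_mul_of_nonneg_left (sub_le_sub_left ham T)
    (mul_pos (mul_pos two_pos hδ0) hVpos).le
  nlinarith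

/-- Halanay's inequality: if `W ≥ 0` is continuous on `[t₀−τ_M, ∞)`,
locally absolutely continuous on `[t₀, ∞)` with a.e. derivative `W'` satisfying
`W'(t) + 2δ₀W(t) − 2δ₁·sup_{θ∈[−τ_M,0]} W(t+θ) ≤ 0` for a.e. `t ≥ t₀`, then
`W(t) ≤ e^{−2δ_{τ_M}(t−t₀)}·sup_{θ∈[−τ_M,0]} W(t₀+θ)` for all `t ≥ t₀`, where
`δ_{τ_M} > 0` is the (unique) positive solution of `δ_{τ_M} = δ₀ − δ₁·e^{2δ_{τ_M}τ_M}`. -/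
theorem halanay_inequality (δ0 δ1 τM t0 : ℝ)
    (h1 : 0 < δ1) (h12 : δ1 < δ0) (hτ : 0 < τM)
    (W W' : ℝ → ℝ)
    (hW_nonneg : ∀ t, t0 - τM ≤ t → 0 ≤ W t)
    (hW_cont : ContinuousOn W (Set.Ici (t0 - τM)))
    (hW'_int : ∀ a b : ℝ, t0 ≤ a → IntervalIntegrable W' volume a b)
    (hW_ftc : ∀ t, t0 ≤ t → W t = W t0 + ∫ s in t0..t, W' s)
    (hineq : ∀ᵐ t ∂volume, t0 ≤ t →
      W' t + 2 * δ0 * W t - 2 * δ1 * sSup (W '' Set.Icc (t - τM) t) ≤ 0)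
    (δτ : ℝ) (hδτ_pos : 0 < δτ)
    (hδτ_eq : δτ = δ0 - δ1 * Real.exp (2 * δτ * τM)) :
    ∀ t, t0 ≤ t →
      W t ≤ Real.exp (-2 * δτ * (t - t0)) * sSup (W '' Set.Icc (t0 - τM) t0) := by
  intro t ht
  have hbdd : BddAbove (W '' Set.Icc (t0 - τM) t0) :=
    (isCompact_Icc.image_of_continuousOn (hW_cont.mono Set.Icc_subset_Ici_self)).bddAbove
  have hle : ∀ s ∈ Set.Icc (t0 - τM) t0, W s ≤ sSup (W '' Set.Icc (t0 - τM) t0) :=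
    fun s hs => le_csSup hbdd (Set.mem_image_of_mem W hs)
  have hsup_nonneg : 0 ≤ sSup (W '' Set.Icc (t0 - τM) t0) :=
    (hW_nonneg t0 (by linarith)).trans (hle t0 ⟨by linarith, le_rfl⟩)
  rw [mul_comm, ← div_le_iff₀ (Real.exp_pos _)]
  refine le_of_forall_gt_imp_ge_of_dense fun K hK => ?_
  rw [div_le_iff₀ (Real.exp_pos _)]
  exact (lt_exp_of_delay_inequality h1 h12 hτ hW_cont hW'_int hW_ftc hineq hδτ_pos hδτ_eq
    (hsup_nonneg.trans_lt hK) (fun s hs => (hle s hs).trans_lt hK) ht).le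
end
end
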